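/- Let n ≥ 2 and let σ be a permutation of {1,…,n} such that the greatest common divisor of the lengths of the cycles of σ (counting fixed points as cycles of length 1) equals 1. Let ℓ be the number of cycles of σ. Then ℓ ≥ 2 and the number of lattice points of P_{δ_n} fixed by σ equals n^{ℓ−2}. -/

import Mathlib

/-- The tuple `δ_n = (n-2, n-3, …, 1, 0, 0)`: its `i`-th coordinate (0-indexed) is
`n - 2 - i` (natural subtraction). -/
def deltaTuple (n : ℕ) : Fin n → ℕ := fun i => n - 2 - (i : ℕ)

/-- The vertices of the permutahedron `P_{δ_n}`: all coordinate permutations of `δ_n`,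
viewed as points of `ℝⁿ`. -/
def permutahedronVerts (n : ℕ) : Set (Fin n → ℝ) :=
  {y | ∃ σ : Equiv.Perm (Fin n), y = fun i => (deltaTuple n (σ i) : ℝ)}

/-- The lattice points of `P_{δ_n}`: integer points whose real image lies in the convex
hull of the coordinate permutations of `δ_n`. -/
def latticePts (n : ℕ) : Set (Fin n → ℤ) :=
  {x | (fun i => (x i : ℝ)) ∈ convexHull ℝ (permutahedronVerts n)}

/-- The number of cycles of a permutation of `Fin n`, counting fixed points as cycles
of length 1. -/
def numCycles {n : ℕ} (σ : Equiv.Perm (Fin n)) : ℕ :=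
  σ.cycleType.card + (Finset.univ.filter fun i => σ i = i).card

/-- The gcd of the lengths of the cycles of a permutation of `Fin n` (counting fixed
points as cycles of length 1); the cycle length of `i` is the minimal period of `σ`
at `i`. -/
noncomputable def cycleGcd {n : ℕ} (σ : Equiv.Perm (Fin n)) : ℕ :=
  Finset.univ.gcd fun i : Fin n => Function.minimalPeriod (⇑σ) i


/-- The inequality description of the lattice points. -/
def IsBreak (n : ℕ) (x : Fin n → ℤ) : Prop :=
  2 * ∑ i, x i = ((n : ℤ) - 1) * (n - 2) ∧
    ∀ S : Finset (Fin n), S.Nonempty →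
      ((S.card : ℤ) - 1) * (S.card - 2) ≤ 2 * ∑ i ∈ S, x i

lemma delta_subset_sum (n : ℕ) (T : Finset (Fin n)) (hT : T.Nonempty) :
    ((T.card : ℤ) - 1) * (T.card - 2) ≤ 2 * ∑ i ∈ T, (deltaTuple n i : ℤ) := by
  induction T using Finset.induction_on_min with
  | empty => simp at hT
  | insert a s ha ih =>
    have hnot : a ∉ s := fun h => lt_irrefl _ (ha a h)
    rw [Finset.sum_insert hnot, Finset.card_insert_of_notMem hnot]
    rcases s.eq_empty_or_nonempty with rfl | hs
    · simp
    · have h1 := ih hs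
      have h2 : s.card ≤ n - 1 - a.val := by
        have : s ⊆ Finset.Ioi a := fun i hi => Finset.mem_Ioi.2 (ha i hi)
        have := Finset.card_le_card this
        rwa [Fin.card_Ioi] at this
      have h3 : (s.card : ℤ) - 1 ≤ (deltaTuple n a : ℤ) := by
        unfold deltaTuple
        have := hs.card_pos
        omega
      push_cast
      nlinarith

lemma delta_initial_sum (n : ℕ) (m : ℕ) (hm : m + 1 ≤ n) :
    2 * ∑ j ∈ Finset.range m, ((n - 2 - j : ℕ) : ℤ)
      = ((n : ℤ) - 1) * (n - 2) - ((n : ℤ) - m - 1) * (n - m - 2) := by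
  induction m with
  | zero => simp
  | succ k ih =>
    rw [Finset.sum_range_succ, mul_add, ih (by omega)]
    have : ((n - 2 - k : ℕ) : ℤ) = n - 2 - k := by omega
    rw [this]; push_cast; ring

lemma delta_total (n : ℕ) (hn : 2 ≤ n) :
    2 * ∑ i, (deltaTuple n i : ℤ) = ((n : ℤ) - 1) * (n - 2) := by
  unfold deltaTuple
  rw [Fin.sum_univ_eq_sum_range (fun j => ((n - 2 - j : ℕ) : ℤ))]
  obtain ⟨k, rfl⟩ : ∃ k, n = k + 1 := ⟨n - 1, by omega⟩
  rw [Finset.sum_range_succ, mul_add, delta_initial_sum _ k le_rfl]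
  have : (k + 1 - 2 - k : ℕ) = 0 := by omega
  rw [this]; push_cast; ring

lemma abel_aux (w d : ℕ → ℝ) (n : ℕ) (hw : ∀ j, j + 1 < n → w j ≤ w (j + 1))
    (hd : ∀ m ≤ n, ∑ j ∈ Finset.range m, d j ≤ 0) (m : ℕ) (hm : m + 1 ≤ n) :
    w m * ∑ j ∈ Finset.range (m + 1), d j ≤ ∑ j ∈ Finset.range (m + 1), w j * d j := by
  induction m with
  | zero => simp
  | succ k ih =>
    have h1 := ih (by omega)
    rw [Finset.sum_range_succ, Finset.sum_range_succ (fun j => w j * d j)]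
    have h2 := hw k (by omega)
    have h3 := hd (k + 1) (by omega)
    nlinarith

lemma initial_sum_conv (n m : ℕ) (hm : m ≤ n) (f : ℕ → ℝ) :
    ∑ j ∈ Finset.range m, f j = ∑ i : Fin n, if (i : ℕ) < m then f i else 0 := by
  rw [Fin.sum_univ_eq_sum_range (fun j => if j < m then f j else 0), ← Finset.sum_filter]
  congr 1
  ext j; simp; omega

lemma mem_lattice_iff (n : ℕ) (hn : 2 ≤ n) (x : Fin n → ℤ) :
    x ∈ latticePts n ↔ IsBreak n x := by
  constructor
  · intro hx
    have hconv : ∀ S : Finset (Fin n), ∀ c : ℝ,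
        Convex ℝ {y : Fin n → ℝ | c ≤ ∑ i ∈ S, y i} := by
      intro S c
      have := convex_halfSpace_ge (𝕜 := ℝ) (f := fun y : Fin n → ℝ => ∑ i ∈ S, y i)
        ⟨fun a b => by simp [Finset.sum_add_distrib], fun a b => by simp [Finset.mul_sum]⟩ c
      exact this
    have hconv2 : ∀ c : ℝ,
        Convex ℝ {y : Fin n → ℝ | ∑ i, y i = c} := by
      intro c
      have := convex_hyperplane (𝕜 := ℝ) (f := fun y : Fin n → ℝ => ∑ i, y i)
        ⟨fun a b => by simp [Finset.sum_add_distrib], fun a b => by simp [Finset.mul_sum]⟩ c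
      exact this
    constructor
    · have h := convexHull_min (s := permutahedronVerts n) ?_
        (hconv2 ((((n : ℤ) - 1) * (n - 2) : ℤ) / 2 : ℝ)) hx
      · have h' : ∑ i, (x i : ℝ) = ((((n : ℤ) - 1) * (n - 2) : ℤ) / 2 : ℝ) := h
        have : (2 : ℝ) * ∑ i, (x i : ℝ) = ((((n : ℤ) - 1) * (n - 2) : ℤ) : ℝ) := by
          rw [h']; ring
        exact_mod_cast this
      · rintro y ⟨τ, rfl⟩
        have h1 := delta_total n hn
        rw [← Equiv.sum_comp τ] at h1
        have h2 : (2 : ℝ) * ∑ i, (deltaTuple n (τ i) : ℝ) = ((((n : ℤ) - 1) * (n - 2) : ℤ) : ℝ) := by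
          exact_mod_cast h1
        show ∑ i, (deltaTuple n (τ i) : ℝ) = _
        rw [← h2]; ring
    · intro S hS
      have h := convexHull_min (s := permutahedronVerts n) ?_
        (hconv S ((((S.card : ℤ) - 1) * (S.card - 2) : ℤ) / 2 : ℝ)) hx
      · have h' : ((((S.card : ℤ) - 1) * (S.card - 2) : ℤ) / 2 : ℝ) ≤ ∑ i ∈ S, (x i : ℝ) := h
        have : ((((S.card : ℤ) - 1) * (S.card - 2) : ℤ) : ℝ) ≤ (2 : ℝ) * ∑ i ∈ S, (x i : ℝ) := by
          linarith
        exact_mod_cast this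
      · rintro y ⟨τ, rfl⟩
        have h1 := delta_subset_sum n (S.map τ.toEmbedding) (by simpa using hS)
        rw [Finset.sum_map, Finset.card_map] at h1
        have h2 : ((((S.card : ℤ) - 1) * (S.card - 2) : ℤ) : ℝ)
            ≤ (2 : ℝ) * ∑ i ∈ S, (deltaTuple n (τ i) : ℝ) := by
          exact_mod_cast h1
        show _ ≤ ∑ i ∈ S, (deltaTuple n (τ i) : ℝ)
        linarith
  · rintro ⟨hsum, hS⟩
    by_contra hx
    have hfin : (permutahedronVerts n).Finite := by
      have : permutahedronVerts n = Set.range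
          (fun σ : Equiv.Perm (Fin n) => fun i => (deltaTuple n (σ i) : ℝ)) := by
        ext y; simp [permutahedronVerts, eq_comm]
      rw [this]; exact Set.finite_range _
    obtain ⟨f, u, h1, h2⟩ := geometric_hahn_banach_point_closed (convex_convexHull ℝ _)
      (hfin.isClosed_convexHull ℝ) hx
    have hf : ∀ y : Fin n → ℝ, f y = ∑ i, y i * f (Pi.single i 1) := by
      intro y
      conv_lhs => rw [pi_eq_sum_univ' y]
      simp [map_sum]
    set w : Fin n → ℝ := fun i => f (Pi.single i 1) with hw
    set τ := Tuple.sort w with hτ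
    have hmono : Monotone (w ∘ τ) := Tuple.monotone_sort w
    have h3 := h2 (fun i => (deltaTuple n (τ.symm i) : ℝ))
      (subset_convexHull ℝ _ ⟨τ.symm, rfl⟩)
    have h4 : f (fun i => (x i : ℝ)) < f (fun i => (deltaTuple n (τ.symm i) : ℝ)) := h1.trans h3
    rw [hf, hf, ← Equiv.sum_comp τ, ← Equiv.sum_comp τ (fun i => (deltaTuple n (τ.symm i) : ℝ) * _)] at h4
    simp only [Equiv.symm_apply_apply] at h4
    let W : ℕ → ℝ := fun j => if h : j < n then w (τ ⟨j, h⟩) else 0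
    let D : ℕ → ℝ := fun j => if h : j < n then x (τ ⟨j, h⟩) - deltaTuple n ⟨j, h⟩ else 0
    have hW : ∀ i : Fin n, W i = w (τ i) := fun i => by simp [W]
    have hD : ∀ i : Fin n, D i = x (τ i) - deltaTuple n i := fun i => by simp [D]
    have htot : ∑ j ∈ Finset.range n, D j = 0 := by
      rw [← Fin.sum_univ_eq_sum_range]
      simp only [hD, Finset.sum_sub_distrib]
      rw [Equiv.sum_comp τ (fun i => (x i : ℝ))]
      have e1 : (2 : ℝ) * ∑ i, (x i : ℝ) = ((((n : ℤ) - 1) * (n - 2) : ℤ) : ℝ) := by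
        exact_mod_cast hsum
      have e2 : (2 : ℝ) * ∑ i, (deltaTuple n i : ℝ) = ((((n : ℤ) - 1) * (n - 2) : ℤ) : ℝ) := by
        exact_mod_cast delta_total n hn
      linarith
    have hpre : ∀ m ≤ n, ∑ j ∈ Finset.range m, D j ≤ 0 := by
      intro m hm
      rcases hm.eq_or_lt with rfl | hm'
      · exact htot.le
      have e1 : ∑ j ∈ Finset.range m, ((n - 2 - j : ℕ) : ℝ)
          = ∑ i : Fin n, if (i : ℕ) < m then (deltaTuple n i : ℝ) else 0 :=
        initial_sum_conv n m hm _
      rw [initial_sum_conv n m hm]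
      have e2 : (∑ i : Fin n, if (i : ℕ) < m then D i else 0)
          = (∑ i : Fin n, if (i : ℕ) < m then (x (τ i) : ℝ) else 0)
            - ∑ i : Fin n, if (i : ℕ) < m then (deltaTuple n i : ℝ) else 0 := by
        rw [← Finset.sum_sub_distrib]
        refine Finset.sum_congr rfl fun i _ => ?_
        rw [hD]; split_ifs <;> simp
      rw [e2, ← e1]
      have e3 : (2 : ℝ) * ∑ j ∈ Finset.range m, ((n - 2 - j : ℕ) : ℝ)
        = ((((n : ℤ) - 1) * (n - 2) - ((n : ℤ) - m - 1) * (n - m - 2) : ℤ) : ℝ) := by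
        exact_mod_cast delta_initial_sum n m hm'
      let T : Finset (Fin n) := Finset.univ.filter fun i => ¬ (i : ℕ) < m
      have hTc : T.card = n - m := by
        have : T = Finset.Ici (⟨m, hm'⟩ : Fin n) := by
          ext i; simp [T, Fin.le_def]
        rw [this, Fin.card_Ici]
      have e4 := hS (T.map τ.toEmbedding) (by
        simp only [Finset.map_nonempty]
        rw [← Finset.card_pos, hTc]; omega)
      rw [Finset.sum_map, Finset.card_map, hTc, Nat.cast_sub hm] at e4
      have e5 : (∑ i ∈ Finset.univ.filter (fun i : Fin n => (i : ℕ) < m), x (τ i))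
          + ∑ i ∈ T, x (τ i) = ∑ i, x i := by
        rw [Finset.sum_filter_add_sum_filter_not, Equiv.sum_comp τ]
      rw [Finset.sum_filter] at e5
      have e6 : 2 * (∑ i : Fin n, if (i : ℕ) < m then x (τ i) else 0) ≤
         ((n : ℤ) - 1) * (n - 2) - ((n : ℤ) - m - 1) * (n - m - 2) := by
        simp only [Equiv.coe_toEmbedding] at e4
        linarith
      have e7 : (2 : ℝ) * (∑ i : Fin n, if (i : ℕ) < m then (x (τ i) : ℝ) else 0) ≤
         ((((n : ℤ) - 1) * (n - 2) - ((n : ℤ) - m - 1) * (n - m - 2) : ℤ) : ℝ) := by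
        exact_mod_cast e6
      linarith
    have hWm : ∀ j, j + 1 < n → W j ≤ W (j + 1) := by
      intro j hj
      have : w (τ ⟨j, by omega⟩) ≤ w (τ ⟨j + 1, hj⟩) := hmono (by simp [Fin.le_def])
      simp only [W, hj, dif_pos, show j < n by omega]
      exact this
    have key := abel_aux W D n hWm hpre (n - 1) (by omega)
    rw [show n - 1 + 1 = n by omega, htot, mul_zero, ← Fin.sum_univ_eq_sum_range (fun j => W j * D j)] at key
    simp only [hW, hD] at key
    have : ∑ i : Fin n, w (τ i) * (x (τ i) - deltaTuple n i)
      = ∑ i, (x (τ i) : ℝ) * w (τ i) - ∑ i, (deltaTuple n i : ℝ) * w (τ i) := by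
      rw [← Finset.sum_sub_distrib]
      exact Finset.sum_congr rfl fun i _ => by ring
    linarith

lemma break_unique (n : ℕ) (hn : 2 ≤ n) (x y : Fin n → ℤ) (hx : IsBreak n x) (hy : IsBreak n y)
    (c : ZMod n) (h : ∀ i, (y i : ZMod n) = x i + c) : y = x := by
  have : NeZero n := ⟨by omega⟩
  have hcong : ∀ i j, (n : ℤ) ∣ (y i - x i) - (y j - x j) := by
    intro i j
    rw [← ZMod.intCast_zmod_eq_zero_iff_dvd]
    push_cast
    rw [h i, h j]; ring
  obtain ⟨i0, -, hi0⟩ := Finset.exists_max_image Finset.univ (fun i => y i - x i)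
    ⟨⟨0, by omega⟩, Finset.mem_univ _⟩
  set D := y i0 - x i0 with hD
  set S := Finset.univ.filter fun i => y i - x i = D with hSdef
  have hS0 : S.Nonempty := ⟨i0, by simp [S, hD]⟩
  have hoff : ∀ i ∈ Sᶜ, y i - x i ≤ D - n := by
    intro i hi
    have h1 : y i - x i ≠ D := by simpa [S] using hi
    have h2 := hi0 i (Finset.mem_univ _)
    have h3 := Int.le_of_dvd (by
      have := lt_of_le_of_ne h2 h1
      omega) (hcong i0 i)
    rw [← hD] at h3
    linarith
  have hon : ∑ i ∈ S, (y i - x i) = S.card * D := by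
    rw [Finset.sum_congr rfl (fun i hi => (Finset.mem_filter.1 hi).2)]
    simp [← hSdef]
  have hoffs : ∑ i ∈ Sᶜ, (y i - x i) ≤ Sᶜ.card * (D - n) := by
    have := Finset.sum_le_card_nsmul _ _ _ hoff
    simpa using this
  have htot : ∑ i ∈ S, (y i - x i) + ∑ i ∈ Sᶜ, (y i - x i) = 0 := by
    rw [Finset.sum_add_sum_compl, Finset.sum_sub_distrib]
    linarith [hx.1, hy.1]
  have hcard : (S.card : ℤ) + Sᶜ.card = n := by
    have := Finset.card_add_card_compl S
    rw [Fintype.card_fin] at this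
    exact_mod_cast this
  rcases Sᶜ.eq_empty_or_nonempty with he | hne
  · rw [hon, he] at htot
    have hSu : S = Finset.univ := by simpa using he
    have hD0 : D = 0 := by
      have : (S.card : ℤ) ≠ 0 := by exact_mod_cast hS0.card_pos.ne'
      simpa [hS0.ne_empty] using htot
    funext i
    have : i ∈ S := by simp [hSu]
    have := (Finset.mem_filter.1 this).2
    linarith
  · exfalso
    have hk : (0 : ℤ) < S.card := by exact_mod_cast hS0.card_pos
    have hm : (0 : ℤ) < Sᶜ.card := by exact_mod_cast hne.card_pos
    have hnpos : (0 : ℤ) < n := by omega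
    have a1 := hx.2 S hS0
    have a2 := hy.2 Sᶜ hne
    have a3 := hy.1
    rw [← Finset.sum_add_sum_compl S] at a3
    rw [Finset.sum_sub_distrib] at hon
    generalize (S.card : ℤ) = k at *
    generalize (Sᶜ.card : ℤ) = m at *
    have hDm : m ≤ D := by
      have : (n : ℤ) * m ≤ n * D := by
        have e1 : k * D + m * (D - n) = n * D - n * m := by rw [← hcard]; ring
        rw [Finset.sum_sub_distrib (s := S), hon] at htot
        linarith
      exact le_of_mul_le_mul_left this hnpos
    rw [← hcard] at a3
    have := mul_le_mul_of_nonneg_left hDm hk.le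
    nlinarith

lemma break_exists (n : ℕ) (hn : 2 ≤ n) (N : ℕ) : ∀ (x : Fin n → ℤ),
    2 * ∑ i, x i = ((n : ℤ) - 1) * (n - 2) → ∑ i, (x i) ^ 2 ≤ N →
    ∃ y, IsBreak n y ∧ ∃ c : ZMod n, ∀ i, (y i : ZMod n) = x i + c := by
  induction N using Nat.strong_induction_on with
  | _ N ih =>
  intro x hx hN
  by_cases hb : IsBreak n x
  · exact ⟨x, hb, 0, by simp⟩
  have : ∃ S : Finset (Fin n), S.Nonempty ∧
      2 * ∑ i ∈ S, x i < ((S.card : ℤ) - 1) * (S.card - 2) := by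
    by_contra hcon
    push Not at hcon
    exact hb ⟨hx, hcon⟩
  obtain ⟨S, hS, hlt⟩ := this
  have hcard : (S.card : ℤ) + Sᶜ.card = n := by
    have := Finset.card_add_card_compl S
    rw [Fintype.card_fin] at this
    exact_mod_cast this
  have hk : (0 : ℤ) < S.card := by exact_mod_cast hS.card_pos
  let z : Fin n → ℤ := fun i => x i - S.card + if i ∈ S then (n : ℤ) else 0
  have hzsum : ∑ i, z i = ∑ i, x i := by
    simp only [z, Finset.sum_add_distrib, Finset.sum_sub_distrib]
    simp
    ring
  have hz2 : ∑ i, (z i) ^ 2 = ∑ i, (x i) ^ 2 + 2 * n * ∑ i ∈ S, x i - 2 * S.card * ∑ i, x i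
      + S.card * (n - S.card) * n := by
    have : ∀ i, (z i) ^ 2 = (x i) ^ 2 + 2 * n * (if i ∈ S then x i else 0) - 2 * S.card * x i
      + (S.card : ℤ) ^ 2 + (if i ∈ S then (n : ℤ) ^ 2 - 2 * n * S.card else 0) := by
      intro i
      simp only [z]
      split_ifs <;> ring
    simp only [this, Finset.sum_add_distrib, Finset.sum_sub_distrib, ← Finset.mul_sum]
    simp
    ring
  have hev : 2 * ∑ i ∈ S, x i + 2 ≤ ((S.card : ℤ) - 1) * (S.card - 2) := by
    have : Even (((S.card : ℤ) - 1) * (S.card - 2)) := by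
      have := Int.even_mul_succ_self ((S.card : ℤ) - 2)
      convert this using 1; ring
    obtain ⟨r, hr⟩ := this
    omega
  have hlt2 : ∑ i, (z i) ^ 2 < ∑ i, (x i) ^ 2 := by
    rw [hz2]
    have hnpos : (0 : ℤ) < n := by omega
    have h1 := mul_le_mul_of_nonneg_left hev hnpos.le
    have h2 : 2 * (S.card : ℤ) * ∑ i, x i = S.card * (((n : ℤ) - 1) * (n - 2)) := by
      rw [← hx]; ring
    rw [h2]
    nlinarith
  have hz0 : 0 ≤ ∑ i, (z i) ^ 2 := Finset.sum_nonneg fun i _ => sq_nonneg _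
  obtain ⟨y, hy, c, hc⟩ := ih (∑ i, (z i) ^ 2).toNat (by omega) z (by rw [hzsum, hx]) (by omega)
  refine ⟨y, hy, c - S.card, fun i => ?_⟩
  rw [hc i]
  simp only [z]
  split_ifs <;> simp <;> ring

lemma break_comp (n : ℕ) (x : Fin n → ℤ) (hx : IsBreak n x) (σ : Equiv.Perm (Fin n)) :
    IsBreak n (fun i => x (σ i)) := by
  refine ⟨by rw [Equiv.sum_comp σ]; exact hx.1, fun S hS => ?_⟩
  have := hx.2 (S.map σ.toEmbedding) (by simpa using hS)
  rwa [Finset.sum_map, Finset.card_map] at this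

/-- Lift a vector mod `n` with the prescribed sum to an integer vector with that exact sum. -/
lemma exists_lift (n : ℕ) (hn : 2 ≤ n) (g : ℤ) (y : Fin n → ZMod n) (hy : ∑ i, y i = g) :
    ∃ x : Fin n → ℤ, ∑ i, x i = g ∧ ∀ i, (x i : ZMod n) = y i := by
  have : NeZero n := ⟨by omega⟩
  let z : Fin n → ℤ := fun i => (y i).val
  have hz : ∀ i, ((z i : ℤ) : ZMod n) = y i := fun i => by simp [z]
  have hdvd : (n : ℤ) ∣ g - ∑ i, z i := by
    rw [← ZMod.intCast_zmod_eq_zero_iff_dvd]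
    push_cast
    simp [hz, hy]
  obtain ⟨q, hq⟩ := hdvd
  let i0 : Fin n := ⟨0, by omega⟩
  refine ⟨fun i => z i + if i = i0 then n * q else 0, ?_, fun i => ?_⟩
  · rw [Finset.sum_add_distrib]; simp; linarith
  · push_cast
    rw [hz]; split_ifs <;> simp

lemma quot_card {n : ℕ} (σ : Equiv.Perm (Fin n)) :
    Nat.card (Quotient (Equiv.Perm.SameCycle.setoid σ)) = numCycles σ := by
  classical
  let F : Fin n → σ.cycleFactorsFinset ⊕ {i : Fin n // σ i = i} := fun i =>
    if h : σ i = i then Sum.inr ⟨i, h⟩ else Sum.inl ⟨σ.cycleOf i, by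
      rw [Equiv.Perm.cycleOf_mem_cycleFactorsFinset_iff, Equiv.Perm.mem_support]; exact h⟩
  have hF : ∀ i j, F i = F j ↔ σ.SameCycle i j := by
    intro i j
    by_cases hi : σ i = i <;> by_cases hj : σ j = j
    · simp only [F, hi, hj, dif_pos, Sum.inr.injEq, Subtype.mk.injEq]
      constructor
      · rintro rfl; exact Equiv.Perm.SameCycle.refl _ _
      · intro h; exact h.eq_of_left hi
    · simp only [F, hi, hj, dif_pos, dif_neg, not_false_eq_true, reduceCtorEq, false_iff]
      intro h
      exact hj (h.apply_eq_self_iff.1 hi)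
    · simp only [F, hi, hj, dif_pos, dif_neg, not_false_eq_true, reduceCtorEq, false_iff]
      intro h
      exact hi (h.apply_eq_self_iff.2 hj)
    · simp only [F, hi, hj, dif_neg, not_false_eq_true, Sum.inl.injEq, Subtype.mk.injEq]
      rw [Equiv.Perm.sameCycle_iff_cycleOf_eq_of_mem_support] <;> simpa
  have e : Function.Bijective (Quotient.lift F (fun a b h => (hF a b).2 h) :
      Quotient (Equiv.Perm.SameCycle.setoid σ) → _) := by
    constructor
    · intro a b
      induction a using Quotient.inductionOn
      induction b using Quotient.inductionOn
      intro h
      exact Quotient.sound ((hF _ _).1 h)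
    · rintro (⟨c, hc⟩ | ⟨i, hi⟩)
      · have hc' := (Equiv.Perm.mem_cycleFactorsFinset_iff.1 hc).1
        obtain ⟨a, ha⟩ := hc'.nonempty_support
        have h1 := Equiv.Perm.cycle_is_cycleOf ha hc
        have h2 : σ a ≠ a := by
          have := Equiv.Perm.mem_cycleFactorsFinset_support_le hc ha
          simpa using this
        refine ⟨Quotient.mk _ a, ?_⟩
        simp [F, h2, h1]
      · exact ⟨Quotient.mk _ i, by simp [F, hi]⟩
  rw [Nat.card_eq_of_bijective _ e, Nat.card_sum, numCycles]
  congr 1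
  · simp [Equiv.Perm.cycleType]
  · rw [Nat.card_eq_fintype_card, Fintype.card_subtype]

lemma fixed_iff {n : ℕ} {A : Type*} (σ : Equiv.Perm (Fin n)) (y : Fin n → A) (h : ∀ i, y (σ i) = y i)
    {i j : Fin n} (hij : σ.SameCycle i j) : y i = y j := by
  obtain ⟨k, -, -, rfl⟩ := hij.exists_pow_eq''
  clear hij
  induction k with
  | zero => simp
  | succ k ih => rw [pow_succ', Equiv.Perm.mul_apply, h, ih]

lemma card_W {n : ℕ} [NeZero n] (σ : Equiv.Perm (Fin n)) :
    Nat.card {y : Fin n → ZMod n // ∀ i, y (σ i) = y i} = n ^ numCycles σ := by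
  let e : {y : Fin n → ZMod n // ∀ i, y (σ i) = y i} ≃
      (Quotient (Equiv.Perm.SameCycle.setoid σ) → ZMod n) :=
    { toFun := fun y => Quotient.lift y.1 (fun a b h => fixed_iff σ y.1 y.2 h)
      invFun := fun f => ⟨fun i => f (Quotient.mk _ i), fun i => by
        apply congrArg f
        exact Quotient.sound (s := Equiv.Perm.SameCycle.setoid σ) (Equiv.Perm.sameCycle_apply_left.2 (Equiv.Perm.SameCycle.refl _ _))⟩
      left_inv := fun y => by ext; rfl
      right_inv := fun f => by
        funext a
        induction a using Quotient.inductionOn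
        rfl }
  rw [Nat.card_congr e, Nat.card_fun, quot_card, Nat.card_zmod]

lemma card_cycle {n : ℕ} [DecidableEq (Fin n)] (σ : Equiv.Perm (Fin n)) [DecidableRel σ.SameCycle] (i : Fin n) :
    (Finset.univ.filter fun j => σ.SameCycle i j).card = Function.minimalPeriod σ i := by
  classical
  have h := MulAction.minimalPeriod_eq_card (a := σ) (b := i)
  have h2 : Function.minimalPeriod σ i = Function.minimalPeriod (σ • ·) i := rfl
  rw [h2, h, ← Fintype.card_subtype]
  refine Fintype.card_congr (Equiv.subtypeEquivRight fun j => ?_)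
  rw [MulAction.mem_orbit_iff]
  constructor
  · rintro ⟨k, hk⟩
    exact ⟨⟨σ ^ k, k, rfl⟩, hk⟩
  · rintro ⟨⟨_, k, rfl⟩, hk⟩
    exact ⟨k, hk⟩

lemma exists_unit_sum {n : ℕ} [NeZero n] (σ : Equiv.Perm (Fin n)) (hg : cycleGcd σ = 1) :
    ∃ u : Fin n → ZMod n, (∀ i, u (σ i) = u i) ∧ ∑ i, u i = 1 := by
  classical
  let H : AddSubgroup ℤ :=
    { carrier := {a | ∃ u : Fin n → ZMod n, (∀ i, u (σ i) = u i) ∧ ∑ i, u i = a}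
      zero_mem' := ⟨0, by simp, by simp⟩
      add_mem' := by
        rintro a b ⟨u, hu, hu'⟩ ⟨v, hv, hv'⟩
        exact ⟨u + v, by simp [hu, hv], by simp [Finset.sum_add_distrib, hu', hv']⟩
      neg_mem' := by
        rintro a ⟨u, hu, hu'⟩
        exact ⟨-u, by simp [hu], by simp [hu']⟩ }
  have hmem : ∀ i, (Function.minimalPeriod σ i : ℤ) ∈ H := by
    intro i
    refine ⟨fun j => if σ.SameCycle i j then 1 else 0, fun j => ?_, ?_⟩
    · simp only [Equiv.Perm.sameCycle_apply_right]
    · rw [Finset.sum_boole, card_cycle]; simp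
  obtain ⟨d, hd⟩ := Int.subgroup_cyclic H
  have hdvd : ∀ i, d ∣ (Function.minimalPeriod σ i : ℤ) := by
    intro i
    have := hmem i
    rw [hd] at this
    rw [← AddSubgroup.zmultiples_eq_closure] at this
    exact Int.mem_zmultiples_iff.1 this
  have h1 : d.natAbs ∣ cycleGcd σ := Finset.dvd_gcd fun i _ => by
    have := Int.natAbs_dvd_natAbs.2 (hdvd i)
    simpa using this
  rw [hg] at h1
  have h2 : (1 : ℤ) ∈ H := by
    rw [hd, ← AddSubgroup.zmultiples_eq_closure, Int.mem_zmultiples_iff]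
    exact Int.natAbs_dvd_natAbs.1 (by simpa using h1)
  obtain ⟨u, hu, hu'⟩ := h2
  exact ⟨u, hu, by simpa using hu'⟩

lemma main_count (n : ℕ) (hn : 2 ≤ n) (σ : Equiv.Perm (Fin n)) (hgcd : cycleGcd σ = 1) :
    Nat.card {x : Fin n → ℤ // IsBreak n x ∧ ∀ i, x (σ i) = x i} * n ^ 2 = n ^ numCycles σ := by
  have : NeZero n := ⟨by omega⟩
  obtain ⟨u, hu, hu1⟩ := exists_unit_sum σ hgcd
  obtain ⟨g, hg⟩ : ∃ g : ℤ, 2 * g = ((n : ℤ) - 1) * (n - 2) := by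
    have := Int.even_mul_succ_self ((n : ℤ) - 2)
    obtain ⟨r, hr⟩ := this
    exact ⟨r, by linarith⟩
  have hsum : ∀ x, IsBreak n x → ∑ i, (x i : ZMod n) = (g : ZMod n) := by
    intro x hx
    have : ∑ i, x i = g := by linarith [hx.1]
    rw [← this]; push_cast; rfl
  rw [← card_W σ]
  have h2 : n ^ 2 = Nat.card (ZMod n × ZMod n) := by
    rw [Nat.card_prod, Nat.card_zmod]; ring
  rw [h2, ← Nat.card_prod]
  let Φ : {x : Fin n → ℤ // IsBreak n x ∧ ∀ i, x (σ i) = x i} × (ZMod n × ZMod n) →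
      {y : Fin n → ZMod n // ∀ i, y (σ i) = y i} := fun p =>
    ⟨fun i => (p.1.1 i : ZMod n) + p.2.1 + p.2.2 * u i, fun i => by
      simp only [p.1.2.2 i, hu]⟩
  refine Nat.card_eq_of_bijective Φ ⟨?_, ?_⟩
  · rintro ⟨⟨x, hx, hxσ⟩, c, t⟩ ⟨⟨x', hx', hxσ'⟩, c', t'⟩ h
    have h : ∀ i, (x i : ZMod n) + c + t * u i = x' i + c' + t' * u i := fun i =>
      congrFun (congrArg Subtype.val h) i
    have ht : t = t' := by
      have := Finset.sum_congr (s₁ := Finset.univ) rfl fun i _ => h i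
      simp only [Finset.sum_add_distrib, ← Finset.mul_sum, hu1, hsum x hx, hsum x' hx'] at this
      simpa using this
    subst ht
    have hxx : x = x' := break_unique n hn x' x hx' hx (c' - c) fun i => by
      linear_combination h i
    subst hxx
    have hc : c = c' := by simpa using h ⟨0, by omega⟩
    subst hc
    rfl
  · rintro ⟨y, hy⟩
    set t : ZMod n := ∑ i, y i - g with ht
    obtain ⟨x0, h0, h0'⟩ := exists_lift n hn g (fun i => y i - t * u i) (by
      rw [Finset.sum_sub_distrib, ← Finset.mul_sum, hu1, ht]; ring)
    obtain ⟨x, hx, c, hc⟩ := break_exists n hn (∑ i, (x0 i) ^ 2).toNat x0 (by rw [h0, hg])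
      (by
        have : 0 ≤ ∑ i, (x0 i) ^ 2 := Finset.sum_nonneg fun i _ => sq_nonneg _
        omega)
    have hxσ : (fun i => x (σ i)) = x := break_unique n hn x _ hx (break_comp n x hx σ) 0 fun i => by
      rw [hc, hc, h0', h0', hy, hu]; ring
    refine ⟨⟨⟨x, hx, fun i => congrFun hxσ i⟩, -c, t⟩, ?_⟩
    apply Subtype.ext
    funext i
    simp only [Φ]
    rw [hc, h0']; ring

/-- If the gcd of the cycle lengths of a permutation `σ` of `{1,…,n}` is `1` and `σ`
has `ℓ` cycles, then `ℓ ≥ 2` and the number of lattice points of `P_{δ_n}` fixed by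
`σ` equals `n^{ℓ-2}`. -/
theorem card_fixed_latticePts_of_gcd_one (n : ℕ) (hn : 2 ≤ n) (σ : Equiv.Perm (Fin n))
    (hgcd : cycleGcd σ = 1) :
    2 ≤ numCycles σ ∧
      Nat.card {x : Fin n → ℤ // x ∈ latticePts n ∧ ∀ i, x (σ i) = x i} =
        n ^ (numCycles σ - 2) := by
  have h1 := main_count n hn σ hgcd
  have hl : 2 ≤ numCycles σ := by
    have h2 : n ^ 2 ∣ n ^ numCycles σ := ⟨_, by rw [← h1, mul_comm]⟩
    exact (Nat.pow_dvd_pow_iff_le_right (by omega)).1 h2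
  refine ⟨hl, ?_⟩
  simp only [mem_lattice_iff n hn]
  have h3 : n ^ numCycles σ = n ^ (numCycles σ - 2) * n ^ 2 := by
    rw [← pow_add]; congr 1; omega
  rw [h3] at h1
  exact Nat.eq_of_mul_eq_mul_right (by positivity) h1
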